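/- arXiv:1906.08153 — 3 statements merged into one kernel-verified Lean document; each statement's English description precedes it below -/
import Mathlib

section
/- For n ≥ 4 even, the fixed-point subalgebra 𝒞ₙ of the inversion automorphism ι on 𝒜ₙ(ℤ_m × ℤ_m, χ) has exactly (m²+3)/2 simple direct summands: it is isomorphic as a ℂ-algebra to M_{(m^{n−2}+1)/2}(ℂ) × M_{(m^{n−2}−1)/2}(ℂ) × (a direct product of (m²−1)/2 copies of M_{m^{n−2}}(ℂ)). -/
/-!
STATEMENT 15: For n ≥ 4 even, the fixed-point subalgebra 𝒞ₙ of the inversion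
automorphism ι on 𝒜ₙ(ℤ_m × ℤ_m, χ) has exactly (m²+3)/2 simple direct
summands: it is isomorphic to M_{(m^{n−2}+1)/2}(ℂ) × M_{(m^{n−2}−1)/2}(ℂ) ×
((m²−1)/2 copies of M_{m^{n−2}}(ℂ)).
-/

namespace Stmt15

/-- Generators u_i, v_i (i = 1,…,n−1, indexed by `Fin N` with `N = n−1`)
of 𝒜ₙ(ℤ_m × ℤ_m, χ). -/
inductive GenA (N : ℕ) : Type
  | u (i : Fin N) : GenA N
  | v (i : Fin N) : GenA N

/-- The underlying index of a generator. -/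
def idx {N : ℕ} : GenA N → ℕ
  | GenA.u i => (i : ℕ)
  | GenA.v i => (i : ℕ)

open GenA in
/-- The defining relations of 𝒜ₙ(ℤ_m × ℤ_m, χ): u_i^m = v_i^m = 1,
u_iv_i = v_iu_i, u_iu_{i+1} = q u_{i+1}u_i, v_iv_{i+1} = q v_{i+1}v_i, and all
other pairs of generators commute. -/
inductive RelA (m N : ℕ) (q : ℂ) :
    FreeAlgebra ℂ (GenA N) → FreeAlgebra ℂ (GenA N) → Prop
  | upow (i : Fin N) : RelA m N q (FreeAlgebra.ι ℂ (u i) ^ m) 1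
  | vpow (i : Fin N) : RelA m N q (FreeAlgebra.ι ℂ (v i) ^ m) 1
  | uvsame (i : Fin N) :
      RelA m N q (FreeAlgebra.ι ℂ (u i) * FreeAlgebra.ι ℂ (v i))
        (FreeAlgebra.ι ℂ (v i) * FreeAlgebra.ι ℂ (u i))
  | uuadj (i j : Fin N) (hij : (j : ℕ) = (i : ℕ) + 1) :
      RelA m N q (FreeAlgebra.ι ℂ (u i) * FreeAlgebra.ι ℂ (u j))
        (q • (FreeAlgebra.ι ℂ (u j) * FreeAlgebra.ι ℂ (u i)))
  | vvadj (i j : Fin N) (hij : (j : ℕ) = (i : ℕ) + 1) :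
      RelA m N q (FreeAlgebra.ι ℂ (v i) * FreeAlgebra.ι ℂ (v j))
        (q • (FreeAlgebra.ι ℂ (v j) * FreeAlgebra.ι ℂ (v i)))
  | uvadj (i j : Fin N) (hij : (j : ℕ) = (i : ℕ) + 1) :
      RelA m N q (FreeAlgebra.ι ℂ (u i) * FreeAlgebra.ι ℂ (v j))
        (FreeAlgebra.ι ℂ (v j) * FreeAlgebra.ι ℂ (u i))
  | vuadj (i j : Fin N) (hij : (j : ℕ) = (i : ℕ) + 1) :
      RelA m N q (FreeAlgebra.ι ℂ (v i) * FreeAlgebra.ι ℂ (u j))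
        (FreeAlgebra.ι ℂ (u j) * FreeAlgebra.ι ℂ (v i))
  | far (a b : GenA N) (hab : 2 ≤ |(idx a : ℤ) - (idx b : ℤ)|) :
      RelA m N q (FreeAlgebra.ι ℂ a * FreeAlgebra.ι ℂ b)
        (FreeAlgebra.ι ℂ b * FreeAlgebra.ι ℂ a)

/-- The algebra 𝒜ₙ(ℤ_m × ℤ_m, χ) (with `N = n − 1`). -/
abbrev AlgA (m N : ℕ) (q : ℂ) : Type := RingQuot (RelA m N q)

/-- The generator u_i of 𝒜ₙ(ℤ_m × ℤ_m, χ). -/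
noncomputable def U (m N : ℕ) (q : ℂ) (i : Fin N) : AlgA m N q :=
  RingQuot.mkAlgHom ℂ (RelA m N q) (FreeAlgebra.ι ℂ (GenA.u i))

/-- The generator v_i of 𝒜ₙ(ℤ_m × ℤ_m, χ). -/
noncomputable def V (m N : ℕ) (q : ℂ) (i : Fin N) : AlgA m N q :=
  RingQuot.mkAlgHom ℂ (RelA m N q) (FreeAlgebra.ι ℂ (GenA.v i))


section spanning

/-- powers span -/
noncomputable def pw {R : Type*} [Ring R] [Algebra ℂ R] (m : ℕ) (x : R) : Submodule ℂ R :=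
  Submodule.span ℂ (Set.range fun i : Fin m => x ^ (i : ℕ))

lemma pow_mem_pw {R : Type*} [Ring R] [Algebra ℂ R] {m : ℕ} [NeZero m] {x : R} (hx : x ^ m = 1)
    (r : ℕ) : x ^ r ∈ pw m x := by
  have h : x ^ r = x ^ (r % m) := by
    conv_lhs => rw [← Nat.div_add_mod r m, pow_add, pow_mul, hx, one_pow, one_mul]
  rw [h]
  exact Submodule.subset_span ⟨⟨r % m, Nat.mod_lt _ (NeZero.pos m)⟩, rfl⟩

lemma pw_mul_self {R : Type*} [Ring R] [Algebra ℂ R] {m : ℕ} [NeZero m] {x : R} (hx : x ^ m = 1) :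
    pw m x * pw m x ≤ pw m x := by
  conv_lhs => rw [pw, Submodule.span_mul_span]
  rw [Submodule.span_le]
  rintro _ ⟨_, ⟨i, rfl⟩, _, ⟨j, rfl⟩, rfl⟩
  simp only [← pow_add]
  exact pow_mem_pw hx _

lemma qcomm_pow {R : Type*} [Ring R] [Algebra ℂ R] {x y : R} {c : ℂ} (h : x * y = c • (y * x))
    (i j : ℕ) : ∃ d : ℂ, x ^ i * y ^ j = d • (y ^ j * x ^ i) := by
  have h1 : ∀ j : ℕ, x * y ^ j = c ^ j • (y ^ j * x) := by
    intro j
    induction j with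
    | zero => simp
    | succ j ih =>
      rw [pow_succ, ← mul_assoc, ih, smul_mul_assoc, mul_assoc, h, mul_smul_comm, smul_smul,
        mul_assoc, pow_succ]
  refine ⟨(c ^ j) ^ i, ?_⟩
  induction i with
  | zero => simp
  | succ i ih =>
    rw [pow_succ, mul_assoc, h1, mul_smul_comm, ← mul_assoc, ih, smul_mul_assoc, smul_smul,
      mul_assoc, pow_succ, mul_comm (c ^ j)]

lemma pw_comm_le {R : Type*} [Ring R] [Algebra ℂ R] {m : ℕ} {x y : R} {c : ℂ}
    (h : x * y = c • (y * x)) : pw m x * pw m y ≤ pw m y * pw m x := by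
  conv_lhs => rw [pw, pw, Submodule.span_mul_span]
  rw [Submodule.span_le]
  rintro _ ⟨_, ⟨i, rfl⟩, _, ⟨j, rfl⟩, rfl⟩
  obtain ⟨d, hd⟩ := qcomm_pow h i j
  simp only [hd]
  exact Submodule.smul_mem _ _ (Submodule.mul_mem_mul (Submodule.subset_span ⟨j, rfl⟩)
    (Submodule.subset_span ⟨i, rfl⟩))

open scoped Pointwise in
lemma list_span {R ι : Type*} [Ring R] [Algebra ℂ R] {m : ℕ} (x : ι → R) (l : List ι) :
    ∃ s : Finset R, s.card ≤ m ^ l.length ∧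
      (l.map fun i => pw m (x i)).prod = Submodule.span ℂ (s : Set R) := by
  classical
  induction l with
  | nil => exact ⟨{1}, by simp, by simp [Submodule.one_eq_span]⟩
  | cons a l ih =>
    obtain ⟨s, hs, h⟩ := ih
    refine ⟨Finset.univ.image (fun i : Fin m => x a ^ (i : ℕ)) * s, ?_, ?_⟩
    · refine Finset.card_mul_le.trans ?_
      rw [List.length_cons, pow_succ, mul_comm]
      refine Nat.mul_le_mul hs (Finset.card_image_le.trans (by simp))
    · rw [List.map_cons, List.prod_cons, h, pw, Submodule.span_mul_span]
      simp

lemma list_absorb {R ι : Type*} [Ring R] [Algebra ℂ R] {m : ℕ} [NeZero m] (x : ι → R)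
    (hx : ∀ i, x i ^ m = 1) (hc : ∀ i j, ∃ c : ℂ, x i * x j = c • (x j * x i)) (l : List ι)
    (a : ι) (ha : a ∈ l) :
    pw m (x a) * (l.map fun i => pw m (x i)).prod ≤ (l.map fun i => pw m (x i)).prod := by
  induction l with
  | nil => simp at ha
  | cons b l ih =>
    rw [List.map_cons, List.prod_cons, ← mul_assoc]
    rcases List.mem_cons.1 ha with rfl | h
    · exact mul_le_mul_left (pw_mul_self (hx _)) _
    · obtain ⟨c, hc⟩ := hc a b
      refine (mul_le_mul_left (pw_comm_le hc) _).trans ?_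
      rw [mul_assoc]
      exact mul_le_mul_right (ih h) _

lemma list_one {R ι : Type*} [Ring R] [Algebra ℂ R] {m : ℕ} [NeZero m] (x : ι → R)
    (hx : ∀ i, x i ^ m = 1) (l : List ι) : (1 : R) ∈ (l.map fun i => pw m (x i)).prod := by
  induction l with
  | nil => exact Submodule.one_le.1 le_rfl
  | cons b l ih =>
    rw [List.map_cons, List.prod_cons, ← one_mul (1 : R)]
    exact Submodule.mul_mem_mul (by simpa using pow_mem_pw (hx b) 0) ih

/-- image of generator -/
noncomputable def gA (m N : ℕ) (q : ℂ) (g : GenA N) : AlgA m N q :=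
  RingQuot.mkAlgHom ℂ (RelA m N q) (FreeAlgebra.ι ℂ g)

lemma gA_pow (m N : ℕ) (q : ℂ) (g : GenA N) : gA m N q g ^ m = 1 := by
  rw [gA, ← map_pow, ← map_one (RingQuot.mkAlgHom ℂ (RelA m N q))]
  cases g
  · exact RingQuot.mkAlgHom_rel ℂ (RelA.upow _)
  · exact RingQuot.mkAlgHom_rel ℂ (RelA.vpow _)

lemma gA_comm_of_rel {m N : ℕ} {q : ℂ} {c : ℂ} (g h : GenA N)
    (H : RelA m N q (FreeAlgebra.ι ℂ g * FreeAlgebra.ι ℂ h)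
      (c • (FreeAlgebra.ι ℂ h * FreeAlgebra.ι ℂ g))) :
    gA m N q g * gA m N q h = c • (gA m N q h * gA m N q g) := by
  simp only [gA, ← map_mul, ← map_smul]
  exact RingQuot.mkAlgHom_rel ℂ H

lemma gA_comm_le {m N : ℕ} {q : ℂ} (hq : q ≠ 0) (g h : GenA N) (hle : idx g ≤ idx h) :
    ∃ c : ℂ, c ≠ 0 ∧ gA m N q g * gA m N q h = c • (gA m N q h * gA m N q g) := by
  rcases (by omega : idx g = idx h ∨ idx h = idx g + 1 ∨ idx g + 2 ≤ idx h) with h0 | h0 | h0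
  · cases g <;> cases h <;> simp only [idx, Fin.val_inj] at h0 <;> subst h0
    · exact ⟨1, one_ne_zero, by simp⟩
    · exact ⟨1, one_ne_zero, gA_comm_of_rel _ _ (by rw [one_smul]; exact RelA.uvsame _)⟩
    · refine ⟨1, one_ne_zero, ?_⟩
      rename_i i
      have := gA_comm_of_rel (m := m) (N := N) (q := q) (c := 1) (GenA.u i) (GenA.v i)
        (by rw [one_smul]; exact RelA.uvsame i)
      rw [one_smul] at this ⊢
      exact this.symm
    · exact ⟨1, one_ne_zero, by simp⟩
  · cases g <;> cases h <;> simp only [idx] at h0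
    · exact ⟨q, hq, gA_comm_of_rel _ _ (RelA.uuadj _ _ h0)⟩
    · exact ⟨1, one_ne_zero, gA_comm_of_rel _ _ (by rw [one_smul]; exact RelA.uvadj _ _ h0)⟩
    · exact ⟨1, one_ne_zero, gA_comm_of_rel _ _ (by rw [one_smul]; exact RelA.vuadj _ _ h0)⟩
    · exact ⟨q, hq, gA_comm_of_rel _ _ (RelA.vvadj _ _ h0)⟩
  · have H : 2 ≤ |(idx g : ℤ) - (idx h : ℤ)| := by
      rw [abs_sub_comm]
      exact le_abs.2 (Or.inl (by omega))
    exact ⟨1, one_ne_zero, gA_comm_of_rel _ _ (by rw [one_smul]; exact RelA.far _ _ H)⟩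

lemma gA_comm {m N : ℕ} {q : ℂ} (hq : q ≠ 0) (g h : GenA N) :
    ∃ c : ℂ, gA m N q g * gA m N q h = c • (gA m N q h * gA m N q g) := by
  rcases le_total (idx g) (idx h) with hle | hle
  · obtain ⟨c, _, h⟩ := gA_comm_le (m := m) hq g h hle
    exact ⟨c, h⟩
  · obtain ⟨c, hc, h⟩ := gA_comm_le (m := m) hq h g hle
    exact ⟨c⁻¹, by rw [h, smul_smul, inv_mul_cancel₀ hc, one_smul]⟩

/-- all generators -/
def allGens (N : ℕ) : List (GenA N) :=
  (List.finRange N).map GenA.u ++ (List.finRange N).map GenA.v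

lemma A_span (m N : ℕ) [NeZero m] (q : ℂ) (hq : q ≠ 0) :
    ∃ s : Finset (AlgA m N q), s.card ≤ m ^ (2 * N) ∧
      Submodule.span ℂ (s : Set (AlgA m N q)) = ⊤ := by
  obtain ⟨s, hs, h⟩ := list_span (m := m) (gA m N q) (allGens N)
  refine ⟨s, by simpa [allGens, two_mul] using hs, ?_⟩
  rw [← h, eq_top_iff]
  rintro a -
  obtain ⟨b, rfl⟩ := RingQuot.mkAlgHom_surjective ℂ (RelA m N q) a
  set T := ((allGens N).map fun i => pw m (gA m N q i)).prod with hT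
  suffices H : ∀ t ∈ T, RingQuot.mkAlgHom ℂ (RelA m N q) b * t ∈ T by
    simpa using H 1 (list_one _ (gA_pow m N q) _)
  induction b using FreeAlgebra.induction with
  | grade0 r =>
    intro t ht
    rw [AlgHom.commutes, ← Algebra.smul_def]
    exact T.smul_mem _ ht
  | grade1 g =>
    intro t ht
    refine list_absorb (gA m N q) (gA_pow m N q) (gA_comm hq) (allGens N) g ?_
      (Submodule.mul_mem_mul (by simpa [gA] using pow_mem_pw (gA_pow m N q g) 1) ht)
    cases g <;> simp [allGens]
  | mul a b ha hb =>
    intro t ht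
    rw [map_mul, mul_assoc]
    exact ha _ (hb _ ht)
  | add a b ha hb =>
    intro t ht
    rw [map_add, add_mul]
    exact T.add_mem (ha _ ht) (hb _ ht)

end spanning

section rep

set_option linter.unusedSectionVars false

/-- coordinates -/
abbrev XX (m k : ℕ) : Type := Bool × Fin k → ZMod m
/-- central characters -/
abbrev CC (m : ℕ) : Type := Bool → ZMod m
/-- target algebra -/
abbrev BB (m k : ℕ) : Type := CC m → Matrix (XX m k) (XX m k) ℂ

/-- monomial operator -/
def mono {m k : ℕ} (e : AddChar (ZMod m) ℂ) (a : XX m k) (ψ : CC m → XX m k → ZMod m) : BB m k :=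
  fun c => Matrix.of fun x y => if y = x + a then e (ψ c x) else 0

variable {m k : ℕ} [NeZero m] {e : AddChar (ZMod m) ℂ}

lemma mono_mul (a b : XX m k) (ψ θ : CC m → XX m k → ZMod m) :
    mono e a ψ * mono e b θ = mono e (a + b) (fun c x => ψ c x + θ c (x + a)) := by
  ext c x y
  simp only [mono, Pi.mul_apply, Matrix.mul_apply, Matrix.of_apply]
  rw [Finset.sum_eq_single (x + a)]
  · simp only [if_true, add_assoc]
    split_ifs <;> simp [AddChar.map_add_eq_mul]
  · intro z _ hz
    simp [hz]
  · simp

lemma mono_zero : mono e (0 : XX m k) (fun _ _ => 0) = 1 := by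
  ext c x y
  simp [mono, Matrix.one_apply, eq_comm]

lemma mono_smul (a : XX m k) (ψ : CC m → XX m k → ZMod m) (z : ZMod m) :
    e z • mono e a ψ = mono e a (fun c x => z + ψ c x) := by
  ext c x y
  simp only [mono, Pi.smul_apply, Matrix.smul_apply, Matrix.of_apply, smul_eq_mul]
  split_ifs <;> simp [AddChar.map_add_eq_mul]

lemma mono_pow_diag (ψ : CC m → XX m k → ZMod m) (r : ℕ) :
    mono e 0 ψ ^ r = mono e 0 (fun c x => r * ψ c x) := by
  induction r with
  | zero => simp [mono_zero]
  | succ r ih =>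
    rw [pow_succ, ih, mono_mul]
    congr 1
    · simp
    · funext c x; simp; ring

lemma mono_pow_shift (a : XX m k) (r : ℕ) :
    mono e a (fun _ _ => 0) ^ r = mono e ((r : ZMod m) • a) (fun _ _ => 0) := by
  induction r with
  | zero => simp [mono_zero]
  | succ r ih =>
    rw [pow_succ, ih, mono_mul]
    congr 1
    · simp [add_smul]
    · funext c x; simp

/-- unit shift -/
def sh (m k : ℕ) (w : Bool) (j : ℕ) : XX m k := fun p => if p.1 = w ∧ p.2.val = j then 1 else 0

/-- coordinate functions -/
def ext (w : Bool) (j : ℕ) (c : CC m) (x : XX m k) : ZMod m :=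
  if j = 0 then c w else if h : j - 1 < k then x (w, ⟨j - 1, h⟩) else 0

/-- shift part of a generator -/
def Ag (m k : ℕ) (w : Bool) (i : ℕ) : XX m k := if Even i then 0 else sh m k w (i / 2)

/-- phase part of a generator -/
def Lg (w : Bool) (i : ℕ) (c : CC m) (x : XX m k) : ZMod m :=
  if Even i then ext w (i / 2) c x - ext w (i / 2 + 1) c x else 0

lemma ext_shift (w w' : Bool) (j j' : ℕ) (hj : j < k) (c : CC m) (x : XX m k) :
    ext w' j' c (x + sh m k w j) = ext w' j' c x + if w' = w ∧ j' = j + 1 then 1 else 0 := by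
  unfold ext sh
  rcases j' with _ | j'
  · simp
  · simp only [Nat.add_eq_zero_iff, one_ne_zero, and_false, if_false, Nat.add_sub_cancel,
      Nat.add_right_cancel_iff, Pi.add_apply]
    by_cases h : j' < k
    · simp [h]
    · have : j' ≠ j := by omega
      simp [h, this]

lemma Lg_shift (w w' : Bool) (i i' : ℕ) (hi : i < 2 * k + 1) (c : CC m) (x : XX m k) :
    Lg w' i' c (x + Ag m k w i) = Lg w' i' c x +
      (if w' = w ∧ Odd i ∧ i' = i + 1 then 1 else 0) -
      (if w' = w ∧ Odd i ∧ i = i' + 1 then 1 else 0) := by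
  unfold Lg Ag
  by_cases h : Even i
  · have h' : ¬ Odd i := by simpa using h
    simp only [h, h', if_true, add_zero, false_and, and_false, if_false, sub_zero]
  · have h' : Odd i := by simpa using h
    have hj : i / 2 < k := by grind
    by_cases h2 : Even i'
    · simp only [h, h2, if_true, if_false, h', true_and, ext_shift w w' _ _ hj]
      have e1 : i' / 2 = i / 2 + 1 ↔ i' = i + 1 := by grind
      have e2 : i' / 2 + 1 = i / 2 + 1 ↔ i = i' + 1 := by grind
      simp only [e1, e2]
      ring
    · have e1 : ¬ (i' = i + 1) := by grind
      have e2 : ¬ (i = i' + 1) := by grind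
      simp [h2, e1, e2]

/-- generator operator -/
def opg (e : AddChar (ZMod m) ℂ) (w : Bool) (i : ℕ) : BB m k := mono e (Ag m k w i) (Lg w i)

lemma opg_pow (w : Bool) (i : ℕ) : (opg e w i : BB m k) ^ m = 1 := by
  unfold opg
  by_cases h : Even i
  · simp only [Ag, h, if_true]
    rw [mono_pow_diag, ← mono_zero (e := e)]
    simp
  · have : (Lg w i : CC m → XX m k → ZMod m) = fun _ _ => 0 := by
      funext c x; simp [Lg, h]
    rw [this, mono_pow_shift, ← mono_zero (e := e)]
    simp

lemma opg_comm (w w' : Bool) (i i' : ℕ) (hi : i < 2 * k + 1) (hi' : i' < 2 * k + 1)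
    (h : ¬ (w = w' ∧ (i' = i + 1 ∨ i = i' + 1))) :
    (opg e w i : BB m k) * opg e w' i' = opg e w' i' * opg e w i := by
  unfold opg
  rw [mono_mul, mono_mul, add_comm]
  congr 1
  funext c x
  rw [Lg_shift _ _ _ _ hi, Lg_shift _ _ _ _ hi']
  have a1 : ¬ (w' = w ∧ Odd i ∧ i' = i + 1) := by tauto
  have a2 : ¬ (w' = w ∧ Odd i ∧ i = i' + 1) := by tauto
  have a3 : ¬ (w = w' ∧ Odd i' ∧ i' = i + 1) := by tauto
  have a4 : ¬ (w = w' ∧ Odd i' ∧ i = i' + 1) := by tauto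
  simp only [a1, a2, a3, a4, if_false]
  ring

lemma opg_qcomm (w : Bool) (i : ℕ) (hi : i + 1 < 2 * k + 1) :
    (opg e w i : BB m k) * opg e w (i + 1) = e 1 • (opg e w (i + 1) * opg e w i) := by
  unfold opg
  rw [mono_mul, mono_mul, add_comm, mono_smul]
  congr 1
  funext c x
  rw [Lg_shift _ _ _ _ (by omega), Lg_shift _ _ _ _ hi]
  by_cases h : Odd i
  · have : ¬ Odd (i + 1) := by grind
    have h3 : i ≠ i + 1 + 1 := by omega
    simp [h, this, h3]; try ring
  · have : Odd (i + 1) := by grind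
    have h3 : i ≠ i + 1 + 1 := by omega
    simp [h, this, h3]; try ring

/-- colour of a generator -/
def col {N : ℕ} : GenA N → Bool
  | GenA.u _ => true
  | GenA.v _ => false

lemma idx_lt {N : ℕ} (g : GenA N) : idx g < N := by cases g <;> simp [idx]

lemma lift_rel {N : ℕ} (hN : N = 2 * k + 1) {q : ℂ} (hq : e 1 = q) ⦃a b : FreeAlgebra ℂ (GenA N)⦄
    (h : RelA m N q a b) :
    FreeAlgebra.lift ℂ (fun g : GenA N => (opg e (col g) (idx g) : BB m k)) a =
    FreeAlgebra.lift ℂ (fun g : GenA N => (opg e (col g) (idx g) : BB m k)) b := by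
  subst hN
  cases h with
  | upow i => simp [opg_pow]
  | vpow i => simp [opg_pow]
  | uvsame i =>
    simp only [map_mul, FreeAlgebra.lift_ι_apply]
    exact opg_comm _ _ _ _ (idx_lt _) (idx_lt _) (by simp [col])
  | uuadj i j h =>
    simp only [map_mul, map_smul, FreeAlgebra.lift_ι_apply, idx, h, col, ← hq]
    exact opg_qcomm _ _ (by omega)
  | vvadj i j h =>
    simp only [map_mul, map_smul, FreeAlgebra.lift_ι_apply, idx, h, col, ← hq]
    exact opg_qcomm _ _ (by omega)
  | uvadj i j h =>
    simp only [map_mul, FreeAlgebra.lift_ι_apply]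
    exact opg_comm _ _ _ _ (idx_lt _) (idx_lt _) (by simp [col])
  | vuadj i j h =>
    simp only [map_mul, FreeAlgebra.lift_ι_apply]
    exact opg_comm _ _ _ _ (idx_lt _) (idx_lt _) (by simp [col])
  | far g g' h =>
    simp only [map_mul, FreeAlgebra.lift_ι_apply]
    refine opg_comm _ _ _ _ (idx_lt _) (idx_lt _) ?_
    rintro ⟨-, h1 | h1⟩ <;> rw [h1] at h <;> simp at h

/-- the representation -/
noncomputable def rho {N : ℕ} (hN : N = 2 * k + 1) {q : ℂ} (hq : e 1 = q) :
    AlgA m N q →ₐ[ℂ] BB m k :=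
  RingQuot.liftAlgHom ℂ ⟨FreeAlgebra.lift ℂ (fun g : GenA N => (opg e (col g) (idx g) : BB m k)),
    lift_rel hN hq⟩

lemma rho_gA {N : ℕ} (hN : N = 2 * k + 1) {q : ℂ} (hq : e 1 = q) (g : GenA N) :
    rho (k := k) hN hq (gA m N q g) = opg e (col g) (idx g) := by
  simp [rho, gA, RingQuot.liftAlgHom_mkAlgHom_apply]

/-- the parity involution -/
def sig (m k : ℕ) [NeZero m] : BB m k →ₐ[ℂ] BB m k where
  toFun M := fun c => (M (-c)).submatrix (Equiv.neg _) (Equiv.neg _)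
  map_one' := by funext c; exact Matrix.submatrix_one_equiv _
  map_mul' M N := by funext c; simp only [Pi.mul_apply, Matrix.submatrix_mul_equiv]
  map_zero' := by funext c; simp
  map_add' M N := by funext c; simp [Matrix.submatrix_add]
  commutes' r := by
    funext c; ext x y
    simp [Matrix.algebraMap_matrix_apply]

lemma sig_apply (M : BB m k) (c x y) : sig m k M c x y = M (-c) (-x) (-y) := rfl

lemma sig_opg (w : Bool) (i : ℕ) : sig m k (opg e w i) = opg e w i ^ (m - 1) := by
  have h1 : sig m k (opg e w i) * opg e w i = 1 := by
    have : sig m k (opg e w i) = mono e (-Ag m k w i) (fun c x => Lg w i (-c) (-x)) := by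
      ext c x y
      simp only [sig_apply, opg, mono, Matrix.of_apply]
      have : -y = -x + Ag m k w i ↔ y = x + -Ag m k w i := by
        rw [neg_eq_iff_eq_neg, neg_add, neg_neg]
      simp only [this]
    rw [this, opg, mono_mul, ← mono_zero (e := e)]
    congr 1
    · simp
    · funext c x
      by_cases h : Even i
      · simp only [Lg, Ag, ext, h, if_true]
        split_ifs <;> simp
      · simp [Lg, h]
  have hm : m = (m - 1) + 1 := by have := NeZero.pos m; omega
  have h2 : (opg e w i : BB m k) * opg e w i ^ (m - 1) = 1 := by
    rw [← pow_succ', ← hm, opg_pow]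
  exact left_inv_eq_right_inv h1 h2

end rep

section surj

set_option linter.unusedSectionVars false

variable {m k : ℕ} [NeZero m] {e : AddChar (ZMod m) ℂ}

/-- diagonal embedding -/
def dg (m k : ℕ) [NeZero m] : (CC m → XX m k → ℂ) →ₐ[ℂ] BB m k where
  toFun f := fun c => Matrix.diagonal (f c)
  map_one' := by funext c; exact Matrix.diagonal_one
  map_mul' M N := by funext c; simp [Matrix.diagonal_mul_diagonal]
  map_zero' := by funext c; exact Matrix.diagonal_zero
  map_add' M N := by funext c; simp [Matrix.diagonal_add]
  commutes' r := by
    funext c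
    exact (Matrix.algebraMap_eq_diagonal (n := XX m k) (α := ℂ) r).symm

lemma dg_apply (f : CC m → XX m k → ℂ) (c x y) :
    dg m k f c x y = if x = y then f c x else 0 := by
  simp [dg, Matrix.diagonal_apply]

lemma mono_eq_dg (ψ : CC m → XX m k → ZMod m) :
    mono e 0 ψ = dg m k (fun c x => e (ψ c x)) := by
  ext c x y
  simp [mono, dg_apply, eq_comm]

lemma ext_inj {c c' : CC m} {x x' : XX m k}
    (h : ∀ p : Bool × Fin (k + 1), ext p.1 p.2 c x = ext p.1 p.2 c' x') : c = c' ∧ x = x' := by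
  constructor
  · funext w
    simpa [ext] using h (w, 0)
  · funext ⟨w, j⟩
    simpa [ext] using h (w, j.succ)

lemma ind_eq (he : e.IsPrimitive) (c0 : CC m) (x0 : XX m k) (c : CC m) (x : XX m k) :
    (∏ p : Bool × Fin (k + 1), ((m : ℂ)⁻¹ * ∑ r : ZMod m,
      e (r * (ext p.1 p.2 c x - ext p.1 p.2 c0 x0)))) = if c = c0 ∧ x = x0 then 1 else 0 := by
  have hm : (m : ℂ) ≠ 0 := Nat.cast_ne_zero.2 (NeZero.ne m)
  have key : ∀ z : ZMod m, ((m : ℂ)⁻¹ * ∑ r : ZMod m, e (r * z)) = if z = 0 then 1 else 0 := by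
    intro z
    rw [AddChar.sum_mulShift z he]
    split_ifs
    · rw [ZMod.card]; exact inv_mul_cancel₀ hm
    · simp
  simp only [key, sub_eq_zero]
  split_ifs with h
  · obtain ⟨rfl, rfl⟩ := h
    simp
  · by_contra h'
    apply h
    apply ext_inj
    intro p
    by_contra hp
    exact h' (Finset.prod_eq_zero (Finset.mem_univ p) (by simp [hp]))

lemma R_top (he : e.IsPrimitive) (R : Subalgebra ℂ (BB m k))
    (hR : ∀ w i, i < 2 * k + 1 → opg e w i ∈ R) : R = ⊤ := by
  have hadd : ∀ ψ θ : CC m → XX m k → ZMod m, mono e 0 ψ ∈ R → mono e 0 θ ∈ R →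
      mono e 0 (fun c x => ψ c x + θ c x) ∈ R := by
    intro ψ θ h1 h2
    have := R.mul_mem h1 h2
    rw [mono_mul] at this
    simpa using this
  have hext : ∀ w (d j : ℕ), j + d = k + 1 → mono e 0 (fun c x => ext w j c x) ∈ R := by
    intro w d
    induction d with
    | zero =>
      intro j hj
      have : (fun (c : CC m) (x : XX m k) => ext w j c x) = fun _ _ => 0 := by
        funext c x
        have h1 : j ≠ 0 := by omega
        have h2 : ¬ (j - 1 < k) := by omega
        simp [ext, h1, h2]
      rw [this, mono_zero]
      exact R.one_mem
    | succ d ih =>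
      intro j hj
      have h1 := ih (j + 1) (by omega)
      have h2 := hR w (2 * j) (by omega)
      have h3 : (opg e w (2 * j) : BB m k) =
          mono e 0 (fun c x => ext w j c x - ext w (j + 1) c x) := by
        unfold opg
        congr 1
        · simp [Ag]
        · funext c x; simp [Lg]
      rw [h3] at h2
      have := hadd _ _ h2 h1
      simpa using this
  have hmul : ∀ (ψ : CC m → XX m k → ZMod m) (r : ZMod m), mono e 0 ψ ∈ R →
      mono e 0 (fun c x => r * ψ c x) ∈ R := by
    intro ψ r h
    have := R.pow_mem h r.val
    rw [mono_pow_diag] at this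
    simpa using this
  have hind : ∀ c0 x0, dg m k (fun c x => if c = c0 ∧ x = x0 then 1 else 0) ∈ R := by
    intro c0 x0
    have : (fun (c : CC m) (x : XX m k) => if c = c0 ∧ x = x0 then (1 : ℂ) else 0) =
        ∏ p : Bool × Fin (k + 1), ((m : ℂ)⁻¹ • ∑ r : ZMod m, e (-(r * ext p.1 p.2 c0 x0)) •
          fun c x => e (r * ext p.1 p.2 c x)) := by
      funext c x
      rw [← ind_eq he c0 x0 c x, Finset.prod_apply, Finset.prod_apply]
      refine Finset.prod_congr rfl fun p _ => ?_
      simp only [Pi.smul_apply, Finset.sum_apply, smul_eq_mul]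
      congr 1
      refine Finset.sum_congr rfl fun r _ => ?_
      rw [← AddChar.map_add_eq_mul]
      congr 1
      ring
    rw [this]
    refine (R.comap (dg m k)).prod_mem fun p _ => ?_
    rw [Subalgebra.mem_comap, map_smul, map_sum]
    refine R.smul_mem (R.sum_mem fun r _ => ?_) _
    rw [map_smul, ← mono_eq_dg]
    exact R.smul_mem (hmul _ _ (hext p.1 (k + 1 - p.2) p.2 (by omega))) _
  have hdg : ∀ f, dg m k f ∈ R := by
    intro f
    have : f = ∑ c0, ∑ x0, f c0 x0 •
        (fun (c : CC m) (x : XX m k) => if c = c0 ∧ x = x0 then (1 : ℂ) else 0) := by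
      funext c x
      simp only [Finset.sum_apply, Pi.smul_apply, smul_eq_mul, mul_ite, mul_one, mul_zero]
      rw [Finset.sum_eq_single c, Finset.sum_eq_single x] <;> simp +contextual [eq_comm]
    rw [this, map_sum]
    refine R.sum_mem fun c0 _ => ?_
    rw [map_sum]
    refine R.sum_mem fun x0 _ => ?_
    rw [map_smul]
    exact R.smul_mem (hind c0 x0) _
  have hsadd : ∀ a b : XX m k, mono e a (fun _ _ => 0) ∈ R → mono e b (fun _ _ => 0) ∈ R →
      mono e (a + b) (fun _ _ => 0) ∈ R := by
    intro a b h1 h2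
    have := R.mul_mem h1 h2
    rw [mono_mul] at this
    simpa using this
  have hsingle : ∀ p (z : ZMod m), mono e (Pi.single p z : XX m k) (fun _ _ => 0) ∈ R := by
    rintro ⟨w, j⟩ z
    have h2 := hR w (2 * j + 1) (by omega)
    have h3 : (opg e w (2 * j + 1) : BB m k) =
        mono e (Pi.single (w, j) 1) (fun _ _ => 0) := by
      unfold opg
      congr 1
      · have h1 : ¬ Even (2 * (j : ℕ) + 1) := by grind
        have h2 : (2 * (j : ℕ) + 1) / 2 = j := by omega
        funext ⟨w', j'⟩
        simp only [Ag, h1, if_false, h2, sh, Pi.single_apply, Prod.mk.injEq, Fin.ext_iff]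
      · funext c x
        have h1 : ¬ Even (2 * (j : ℕ) + 1) := by grind
        simp only [Lg, h1, if_false]
    rw [h3] at h2
    have := R.pow_mem h2 z.val
    rw [mono_pow_shift] at this
    simpa [← Pi.single_smul] using this
  have hs : ∀ a : XX m k, mono e a (fun _ _ => 0) ∈ R := by
    intro a
    rw [← Finset.univ_sum_single a]
    refine Finset.sum_induction _ (fun a => mono e a (fun _ _ => 0) ∈ R) (fun a b => hsadd a b)
      ?_ ?_
    · rw [mono_zero]; exact R.one_mem
    · intro p _
      exact hsingle p _
  rw [eq_top_iff]
  rintro M -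
  have : M = ∑ a : XX m k, dg m k (fun c x => M c x (x + a)) * mono e a (fun _ _ => 0) := by
    ext c x y
    rw [Finset.sum_apply, Matrix.sum_apply, Finset.sum_eq_single (y - x)]
    · simp [dg, mono, Matrix.diagonal_mul]
    · intro a _ ha
      have : y ≠ x + a := by
        rintro rfl
        simp at ha
      simp [dg, mono, Matrix.diagonal_mul, this]
    · simp
  rw [this]
  exact R.sum_mem fun a _ => R.mul_mem (hdg _) (hs a)

lemma rho_bij {N : ℕ} (hN : N = 2 * k + 1) {q : ℂ} (hq : e 1 = q) (hq0 : q ≠ 0)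
    (he : e.IsPrimitive) : Function.Bijective (rho (k := k) hN hq) := by
  have hsurj : Function.Surjective (rho (k := k) hN hq) := by
    rw [← AlgHom.range_eq_top]
    refine R_top he _ ?_
    intro w i hi
    cases w
    · exact ⟨_, rho_gA hN hq (GenA.v ⟨i, by omega⟩)⟩
    · exact ⟨_, rho_gA hN hq (GenA.u ⟨i, by omega⟩)⟩
  refine ⟨?_, hsurj⟩
  obtain ⟨s, hs, hs'⟩ := A_span m N q hq0
  have hfin : Module.Finite ℂ (AlgA m N q) := ⟨s, hs'⟩
  have h1 : Module.finrank ℂ (AlgA m N q) ≤ m ^ (2 * N) := by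
    rw [← finrank_top, ← hs']
    exact (finrank_span_finset_le_card s).trans hs
  have h2 : Module.finrank ℂ (BB m k) = m ^ (2 * N) := by
    rw [Module.finrank_pi_fintype]
    simp only [Module.finrank_matrix, Finset.sum_const, Finset.card_univ, Fintype.card_pi,
      Finset.prod_const, ZMod.card, Fintype.card_bool, Fintype.card_prod, Fintype.card_fin,
      Module.finrank_self, smul_eq_mul, mul_one]
    rw [hN]
    ring
  have h3 : Module.finrank ℂ (AlgA m N q) = Module.finrank ℂ (BB m k) := by
    refine le_antisymm (h1.trans h2.ge) ?_
    exact LinearMap.finrank_le_finrank_of_surjective (f := (rho (k := k) hN hq).toLinearMap) hsurj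
  exact (LinearMap.injective_iff_surjective_of_finrank_eq_finrank h3
    (f := (rho (k := k) hN hq).toLinearMap)).2 hsurj

end surj

section fixed

lemma half {G : Type*} [AddCommGroup G] [Fintype G] [DecidableEq G]
    (h2 : ∀ x : G, -x = x → x = 0) : ∃ S : Finset G, 0 ∉ S ∧ (∀ x, x ≠ 0 → (-x ∈ S ↔ x ∉ S)) ∧
      Fintype.card G = 2 * S.card + 1 := by
  let f := Fintype.equivFin G
  let S : Finset G := Finset.univ.filter fun x => f x < f (-x)
  have h0 : (0 : G) ∉ S := by simp [S]
  have hS : ∀ x, x ≠ 0 → (-x ∈ S ↔ x ∉ S) := by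
    intro x hx
    simp only [S, Finset.mem_filter, Finset.mem_univ, true_and, neg_neg, not_lt]
    refine ⟨le_of_lt, fun h => lt_of_le_of_ne h fun h' => hx (h2 x (f.injective h'))⟩
  refine ⟨S, h0, hS, ?_⟩
  have hu : (Finset.univ : Finset G) = insert 0 (S ∪ S.image Neg.neg) := by
    ext x
    simp only [Finset.mem_univ, Finset.mem_insert, Finset.mem_union, Finset.mem_image, true_iff]
    by_cases hx : x = 0
    · exact Or.inl hx
    · by_cases hx' : x ∈ S
      · exact Or.inr (Or.inl hx')
      · exact Or.inr (Or.inr ⟨-x, (hS x hx).2 hx', neg_neg x⟩)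
  rw [← Finset.card_univ, hu, Finset.card_insert_of_notMem, Finset.card_union_of_disjoint,
    Finset.card_image_of_injective _ neg_injective]
  · ring
  · rw [Finset.disjoint_left]
    intro x hx hx'
    obtain ⟨y, hy, rfl⟩ := Finset.mem_image.1 hx'
    have : y ≠ 0 := fun h => h0 (h ▸ hy)
    exact (hS y this).1 hx hy
  · simp [h0]

variable {G : Type*} [AddCommGroup G] [Fintype G] [DecidableEq G]

lemma odd_even_zero {I J : Type*} [Fintype I] [Fintype J] {L : Matrix I G ℂ} {R : Matrix G J ℂ}
    {N : Matrix G G ℂ} (hN : N.submatrix (Equiv.neg G) (Equiv.neg G) = N)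
    (h : (L.submatrix id (Equiv.neg G) = L ∧ R.submatrix (Equiv.neg G) id = -R) ∨
      (L.submatrix id (Equiv.neg G) = -L ∧ R.submatrix (Equiv.neg G) id = R)) :
    L * N * R = 0 := by
  have h1 : L * N * R = L.submatrix id (Equiv.neg G) * N.submatrix (Equiv.neg G) (Equiv.neg G) *
      R.submatrix (Equiv.neg G) id := by
    rw [Matrix.submatrix_mul_equiv, Matrix.submatrix_mul_equiv, Matrix.submatrix_id_id]
  rw [hN] at h1
  have h2 : L * N * R = -(L * N * R) := by
    rcases h with ⟨ha, hb⟩ | ⟨ha, hb⟩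
    · conv_lhs => rw [h1, ha, hb, Matrix.mul_neg]
    · conv_lhs => rw [h1, ha, hb, Matrix.neg_mul, Matrix.neg_mul]
  ext i j
  have := congrFun (congrFun h2 i) j
  simp only [Matrix.neg_apply] at this
  simpa using self_eq_neg.1 this

lemma parity_data_aux (S : Finset G) (h0 : 0 ∉ S) (hS : ∀ x, x ≠ 0 → (-x ∈ S ↔ x ∉ S)) :
    ∃ (E : Matrix G (Option S) ℂ) (E' : Matrix (Option S) G ℂ) (O : Matrix G S ℂ)
      (O' : Matrix S G ℂ),
      E' * E = 1 ∧ O' * O = 1 ∧ E * E' + O * O' = 1 ∧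
      E.submatrix (Equiv.neg G) id = E ∧ E'.submatrix id (Equiv.neg G) = E' ∧
      O.submatrix (Equiv.neg G) id = -O ∧ O'.submatrix id (Equiv.neg G) = -O' := by
  have hs0 : ∀ s : S, (s : G) ≠ 0 := fun s h => h0 (h ▸ s.2)
  have hs0' : ∀ s : S, (0 : G) ≠ s := fun s h => hs0 s h.symm
  have hneg : ∀ s t : S, (s : G) ≠ -(t : G) := fun s t h =>
    (hS t (hs0 t)).1 (h ▸ s.2) t.2
  have hneg' : ∀ s t : S, -(s : G) ≠ (t : G) := fun s t h => hneg t s h.symm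
  let δ : G → G → ℂ := fun x y => if x = y then 1 else 0
  have hδn : ∀ x y, δ (-x) (-y) = δ x y := by intro x y; simp [δ]
  have hδn1 : ∀ x y, δ (-x) y = δ x (-y) := by intro x y; simp [δ, neg_eq_iff_eq_neg]
  have hsum : ∀ a b : G, ∑ x, δ x a * δ x b = δ a b := by
    intro a b
    simp only [δ, mul_ite, mul_one, mul_zero]
    by_cases h : a = b
    · simp [h]
    · have h' : b ≠ a := fun h' => h h'.symm
      simp [h, h']
  have hst : ∀ s t : S, δ s (-(t : G)) = 0 := by intro s t; simp [δ, hneg s t]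
  have hst' : ∀ s t : S, δ (-(s : G)) t = 0 := by intro s t; simp [δ, hneg' s t]
  have hz : ∀ t : S, δ 0 t = 0 := by intro t; simp [δ, hs0' t]
  have hz1 : ∀ t : S, δ 0 (-(t : G)) = 0 := by intro t; simp [δ, hs0 t]
  have hz2 : ∀ t : S, δ t 0 = 0 := by intro t; simp [δ, hs0 t]
  have hz3 : ∀ t : S, δ (-(t : G)) 0 = 0 := by intro t; simp [δ, hs0 t]
  refine ⟨Matrix.of fun x o => o.elim (δ x 0) (fun s => δ x s + δ x (-(s : G))),
    Matrix.of fun o x => o.elim (δ x 0) (fun s => 2⁻¹ * (δ x s + δ x (-(s : G)))),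
    Matrix.of fun x s => δ x s - δ x (-(s : G)),
    Matrix.of fun s x => 2⁻¹ * (δ x s - δ x (-(s : G))), ?_, ?_, ?_, ?_, ?_, ?_, ?_⟩
  · ext o o'
    rw [Matrix.mul_apply]
    rcases o with _ | s <;> rcases o' with _ | t <;>
      simp only [Matrix.of_apply, Option.elim_none, Option.elim_some, mul_add, add_mul, mul_assoc,
        Finset.sum_add_distrib, ← Finset.mul_sum, hsum, hst, hst', hz, hz1, hz2, hz3, hδn]
    · simp [δ]
    · simp
    · simp
    · simp only [δ, Matrix.one_apply, Option.some_inj, Subtype.coe_inj]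
      split_ifs <;> norm_num
  · ext s t
    rw [Matrix.mul_apply]
    simp only [Matrix.of_apply, mul_sub, sub_mul, mul_assoc,
        Finset.sum_sub_distrib, ← Finset.mul_sum, hsum, hst, hst', hδn]
    simp only [δ, Matrix.one_apply, Subtype.coe_inj]
    split_ifs <;> norm_num
  · ext x y
    rw [Matrix.add_apply, Matrix.mul_apply, Matrix.mul_apply, Fintype.sum_option, add_assoc,
      ← Finset.sum_add_distrib]
    simp only [Matrix.of_apply, Option.elim_none, Option.elim_some]
    have h1 : ∀ s : S, (δ x s + δ x (-(s : G))) * (2⁻¹ * (δ y s + δ y (-(s : G)))) +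
        (δ x s - δ x (-(s : G))) * (2⁻¹ * (δ y s - δ y (-(s : G)))) =
        δ x s * δ y s + δ (-x) s * δ (-y) s := by
      intro s
      rw [hδn1, hδn1]
      ring
    simp only [h1]
    have h2 : ∀ a b : G, ∑ s : S, δ a s * δ b s = if a ∈ S then δ a b else 0 := by
      intro a b
      rw [Finset.sum_coe_sort S (fun s => δ a s * δ b s)]
      by_cases h : a = b
      · simp [δ, h]
      · have : ∀ s ∈ S, δ a s * δ b s = 0 := by
          intro s _
          by_cases h1 : a = s
          · have h3 : b ≠ s := fun h3 => h (h1.trans h3.symm)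
            simp [δ, h3]
          · simp [δ, h1]
        rw [Finset.sum_eq_zero this]
        simp [δ, h]
    rw [Finset.sum_add_distrib, h2, h2, hδn]
    by_cases hx : x = 0
    · subst hx
      simp [h0, δ, Matrix.one_apply, eq_comm]
    · have := hS x hx
      by_cases hxS : x ∈ S
      · have h3 : -x ∉ S := by tauto
        simp [hxS, h3, δ, hx, Matrix.one_apply]
      · have h3 : -x ∈ S := by tauto
        simp [hxS, h3, δ, hx, Matrix.one_apply]
  · ext x o
    rcases o with _ | s
    · simp [δ]
    · simp [hδn1, hδn, add_comm]
  · ext o x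
    rcases o with _ | s
    · simp [δ]
    · simp [hδn1, hδn, add_comm]
  · ext x s
    simp [hδn1, hδn]
  · ext s x
    simp [hδn1, hδn]
    ring

lemma parity_data (h2 : ∀ x : G, -x = x → x = 0) (a b : ℕ) (ha : a = (Fintype.card G + 1) / 2)
    (hb : b = (Fintype.card G - 1) / 2) :
    ∃ (E : Matrix G (Fin a) ℂ) (E' : Matrix (Fin a) G ℂ) (O : Matrix G (Fin b) ℂ)
      (O' : Matrix (Fin b) G ℂ),
      E' * E = 1 ∧ O' * O = 1 ∧ E * E' + O * O' = 1 ∧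
      E.submatrix (Equiv.neg G) id = E ∧ E'.submatrix id (Equiv.neg G) = E' ∧
      O.submatrix (Equiv.neg G) id = -O ∧ O'.submatrix id (Equiv.neg G) = -O' := by
  obtain ⟨S, h0, hS, hc⟩ := half h2
  obtain ⟨E, E', O, O', h1, h2, h3, h4, h5, h6, h7⟩ := parity_data_aux S h0 hS
  have ea : Fin a ≃ Option S := Fintype.equivOfCardEq (by simp; omega)
  have eb : Fin b ≃ S := Fintype.equivOfCardEq (by simp; omega)
  refine ⟨E.submatrix id ea, E'.submatrix ea id, O.submatrix id eb, O'.submatrix eb id,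
    ?_, ?_, ?_, ?_, ?_, ?_, ?_⟩
  · rw [← Matrix.submatrix_mul _ _ _ _ _ Function.bijective_id, h1, Matrix.submatrix_one_equiv]
  · rw [← Matrix.submatrix_mul _ _ _ _ _ Function.bijective_id, h2, Matrix.submatrix_one_equiv]
  · rw [Matrix.submatrix_mul_equiv, Matrix.submatrix_mul_equiv]
    simpa using h3
  · ext x i
    exact congrFun (congrFun h4 x) (ea i)
  · ext i x
    exact congrFun (congrFun h5 (ea i)) x
  · ext x i
    exact congrFun (congrFun h6 x) (eb i)
  · ext i x
    exact congrFun (congrFun h7 (eb i)) x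

end fixed

section final

variable {m k : ℕ} [NeZero m]

lemma no_two_torsion {ι : Type*} (hodd : Odd m) (x : ι → ZMod m) (h : -x = x) : x = 0 := by
  funext i
  have h1 : -x i = x i := congrFun h i
  have h2 : (2 : ZMod m) * x i = 0 := by
    rw [two_mul]; nth_rewrite 1 [← h1]; simp
  have h3 : IsUnit (2 : ZMod m) := by
    have := (ZMod.isUnit_iff_coprime 2 m).2 (by simpa using hodd)
    simpa using this
  exact (h3.mul_right_eq_zero).1 h2

lemma fixed_equiv (hodd : Odd m) (a b t d : ℕ) (ha : a = (m ^ (2 * k) + 1) / 2)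
    (hb : b = (m ^ (2 * k) - 1) / 2) (ht : t = (m ^ 2 - 1) / 2) (hd : d = m ^ (2 * k)) :
    Nonempty ((AlgHom.equalizer (sig m k) (AlgHom.id ℂ (BB m k))) ≃ₐ[ℂ]
      (Matrix (Fin a) (Fin a) ℂ × Matrix (Fin b) (Fin b) ℂ ×
        (Fin t → Matrix (Fin d) (Fin d) ℂ))) := by
  have cX : Fintype.card (XX m k) = m ^ (2 * k) := by simp
  obtain ⟨E, E', O, O', h1, h2, h3, h4, h5, h6, h7⟩ :=
    parity_data (G := XX m k) (no_two_torsion hodd) a b (by rw [cX, ha]) (by rw [cX, hb])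
  obtain ⟨S, s0, hS, hc⟩ := half (G := CC m) (no_two_torsion hodd)
  have cC : Fintype.card (CC m) = m ^ 2 := by simp
  have κ : Fin t ≃ S := Fintype.equivOfCardEq (by simp; omega)
  have eX : XX m k ≃ Fin d := Fintype.equivOfCardEq (by rw [cX, hd]; simp)
  let F := AlgHom.equalizer (sig m k) (AlgHom.id ℂ (BB m k))
  have hF : ∀ M : BB m k, M ∈ F ↔ ∀ c, (M (-c)).submatrix (Equiv.neg _) (Equiv.neg _) = M c := by
    intro M
    exact funext_iff
  have hF0 : ∀ M : F, ((M : BB m k) 0).submatrix (Equiv.neg _) (Equiv.neg _) = (M : BB m k) 0 := by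
    intro M
    simpa using (hF _).1 M.2 0
  have z1 : ∀ M : F, E' * (M : BB m k) 0 * O = 0 := fun M =>
    odd_even_zero (hF0 M) (Or.inl ⟨h5, h6⟩)
  have z2 : ∀ M : F, O' * (M : BB m k) 0 * E = 0 := fun M =>
    odd_even_zero (hF0 M) (Or.inr ⟨h7, h4⟩)
  have z3 : E' * O = 0 := by
    have := odd_even_zero (L := E') (R := O) (N := 1) (Matrix.submatrix_one_equiv _)
      (Or.inl ⟨h5, h6⟩)
    simpa using this
  have z4 : O' * E = 0 := by
    have := odd_even_zero (L := O') (R := E) (N := 1) (Matrix.submatrix_one_equiv _)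
      (Or.inr ⟨h7, h4⟩)
    simpa using this
  let Ψ : F →ₐ[ℂ] (Matrix (Fin a) (Fin a) ℂ × Matrix (Fin b) (Fin b) ℂ ×
        (Fin t → Matrix (Fin d) (Fin d) ℂ)) :=
    { toFun := fun M => (E' * (M : BB m k) 0 * E, O' * (M : BB m k) 0 * O,
        fun i => Matrix.reindexAlgEquiv ℂ ℂ eX ((M : BB m k) (κ i)))
      map_one' := by
        refine Prod.ext ?_ (Prod.ext ?_ ?_)
        · simp [h1]
        · simp [h2]
        · funext i
          simp only [OneMemClass.coe_one, Pi.one_apply, map_one]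
          rfl
      map_mul' := by
        intro M N
        refine Prod.ext ?_ (Prod.ext ?_ ?_)
        · change E' * ((M : BB m k) 0 * (N : BB m k) 0) * E =
            (E' * (M : BB m k) 0 * E) * (E' * (N : BB m k) 0 * E)
          have : E' * ((M : BB m k) 0 * (N : BB m k) 0) * E =
              E' * (M : BB m k) 0 * (E * E' + O * O') * ((N : BB m k) 0 * E) := by
            rw [h3]; simp only [Matrix.mul_one, Matrix.mul_assoc]
          rw [this, Matrix.mul_add, ← Matrix.mul_assoc _ O, z1, Matrix.zero_mul, add_zero]
          simp only [Matrix.mul_assoc]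
        · change O' * ((M : BB m k) 0 * (N : BB m k) 0) * O =
            (O' * (M : BB m k) 0 * O) * (O' * (N : BB m k) 0 * O)
          have : O' * ((M : BB m k) 0 * (N : BB m k) 0) * O =
              O' * (M : BB m k) 0 * (E * E' + O * O') * ((N : BB m k) 0 * O) := by
            rw [h3]; simp only [Matrix.mul_one, Matrix.mul_assoc]
          rw [this, Matrix.mul_add, ← Matrix.mul_assoc _ E, z2, Matrix.zero_mul, zero_add]
          simp only [Matrix.mul_assoc]
        · funext i
          exact map_mul (Matrix.reindexAlgEquiv ℂ ℂ eX) _ _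
      map_zero' := by
        refine Prod.ext ?_ (Prod.ext ?_ ?_)
        · simp
        · simp
        · funext i
          exact map_zero (Matrix.reindexAlgEquiv ℂ ℂ eX)
      map_add' := by
        intro M N
        refine Prod.ext ?_ (Prod.ext ?_ ?_)
        · simp [Matrix.mul_add, Matrix.add_mul]
        · simp [Matrix.mul_add, Matrix.add_mul]
        · funext i
          exact map_add (Matrix.reindexAlgEquiv ℂ ℂ eX) _ _
      commutes' := by
        intro r
        refine Prod.ext ?_ (Prod.ext ?_ ?_)
        · change E' * (algebraMap ℂ (Matrix (XX m k) (XX m k) ℂ) r) * E =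
            algebraMap ℂ (Matrix (Fin a) (Fin a) ℂ) r
          rw [Algebra.algebraMap_eq_smul_one, Algebra.algebraMap_eq_smul_one, Matrix.mul_smul,
            Matrix.smul_mul, Matrix.mul_one, h1]
        · change O' * (algebraMap ℂ (Matrix (XX m k) (XX m k) ℂ) r) * O =
            algebraMap ℂ (Matrix (Fin b) (Fin b) ℂ) r
          rw [Algebra.algebraMap_eq_smul_one, Algebra.algebraMap_eq_smul_one, Matrix.mul_smul,
            Matrix.smul_mul, Matrix.mul_one, h2]
        · funext i
          exact (Matrix.reindexAlgEquiv ℂ ℂ eX).commutes r }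
  have hrec : ∀ M : F, (M : BB m k) 0 = E * (E' * (M : BB m k) 0 * E) * E' +
      O * (O' * (M : BB m k) 0 * O) * O' := by
    intro M
    have e1 : (M : BB m k) 0 = (E * E' + O * O') * (M : BB m k) 0 * (E * E' + O * O') := by
      rw [h3, Matrix.one_mul, Matrix.mul_one]
    have w1 : E * E' * (M : BB m k) 0 * (O * O') = 0 := by
      have : E * E' * (M : BB m k) 0 * (O * O') = E * (E' * (M : BB m k) 0 * O) * O' := by
        simp only [Matrix.mul_assoc]
      rw [this, z1]; simp
    have w2 : O * O' * (M : BB m k) 0 * (E * E') = 0 := by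
      have : O * O' * (M : BB m k) 0 * (E * E') = O * (O' * (M : BB m k) 0 * E) * E' := by
        simp only [Matrix.mul_assoc]
      rw [this, z2]; simp
    rw [Matrix.add_mul, Matrix.mul_add, Matrix.add_mul, Matrix.add_mul, w1, w2] at e1
    conv_lhs => rw [e1]
    simp [Matrix.mul_assoc]
  refine ⟨AlgEquiv.ofBijective Ψ ⟨?_, ?_⟩⟩
  · intro M N hMN
    have q1 : E' * (M : BB m k) 0 * E = E' * (N : BB m k) 0 * E := congrArg (fun p => p.1) hMN
    have q2 : O' * (M : BB m k) 0 * O = O' * (N : BB m k) 0 * O := congrArg (fun p => p.2.1) hMN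
    have q3 : ∀ i, (M : BB m k) (κ i) = (N : BB m k) (κ i) := by
      intro i
      apply (Matrix.reindexAlgEquiv ℂ ℂ eX).injective
      exact congrFun (congrArg (fun p => p.2.2) hMN) i
    have q4 : ∀ c ∈ S, (M : BB m k) c = (N : BB m k) c := by
      intro c hc
      simpa using q3 (κ.symm ⟨c, hc⟩)
    apply Subtype.ext
    funext c
    by_cases h0 : c = 0
    · rw [h0, hrec M, hrec N, q1, q2]
    · by_cases hcS : c ∈ S
      · exact q4 c hcS
      · rw [← (hF _).1 M.2 c, ← (hF _).1 N.2 c, q4 _ ((hS c h0).2 hcS)]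
  · rintro ⟨A, B, K⟩
    let K' : CC m → Matrix (XX m k) (XX m k) ℂ := fun c =>
      if h : c ∈ S then (Matrix.reindexAlgEquiv ℂ ℂ eX).symm (K (κ.symm ⟨c, h⟩)) else 0
    let M0 : Matrix (XX m k) (XX m k) ℂ := E * A * E' + O * B * O'
    have hM0 : M0.submatrix (Equiv.neg _) (Equiv.neg _) = M0 := by
      have e1 : (E * A * E').submatrix (Equiv.neg _) (Equiv.neg _) = E.submatrix (Equiv.neg _) id *
          A * E'.submatrix id (Equiv.neg _) := by
        ext x y; simp [Matrix.mul_apply]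
      have e2 : (O * B * O').submatrix (Equiv.neg _) (Equiv.neg _) = O.submatrix (Equiv.neg _) id *
          B * O'.submatrix id (Equiv.neg _) := by
        ext x y; simp [Matrix.mul_apply]
      change (E * A * E' + O * B * O').submatrix (Equiv.neg _) (Equiv.neg _) = _
      rw [Matrix.submatrix_add]
      change (E * A * E').submatrix (Equiv.neg _) (Equiv.neg _) +
        (O * B * O').submatrix (Equiv.neg _) (Equiv.neg _) = _
      rw [e1, e2, h4, h5, h6, h7]
      simp [M0]
    let M : BB m k := fun c => if c = 0 then M0 else if c ∈ S then K' c else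
      (K' (-c)).submatrix (Equiv.neg _) (Equiv.neg _)
    have hM : M ∈ F := by
      rw [hF]
      intro c
      by_cases h0 : c = 0
      · simpa [M, h0] using hM0
      · have h0' : -c ≠ 0 := by simpa using h0
        by_cases hcS : c ∈ S
        · have : -c ∉ S := fun h => (hS c h0).1 h hcS
          simp only [M, h0, h0', hcS, this, if_true, if_false, neg_neg]
          ext x y; simp
        · have : -c ∈ S := (hS c h0).2 hcS
          simp only [M, h0, h0', hcS, this, if_true, if_false]
    refine ⟨⟨M, hM⟩, ?_⟩
    have hMz : M 0 = M0 := by simp [M]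
    refine Prod.ext ?_ (Prod.ext ?_ ?_)
    · change E' * M 0 * E = A
      have : E' * M 0 * E = (E' * E) * A * (E' * E) + (E' * O) * B * (O' * E) := by
        rw [hMz]; simp only [M0, Matrix.mul_add, Matrix.add_mul, Matrix.mul_assoc]
      rw [this, h1, z3]; simp
    · change O' * M 0 * O = B
      have : O' * M 0 * O = (O' * E) * A * (E' * O) + (O' * O) * B * (O' * O) := by
        rw [hMz]; simp only [M0, Matrix.mul_add, Matrix.add_mul, Matrix.mul_assoc]
      rw [this, h2, z3]; simp
    · funext i
      change Matrix.reindexAlgEquiv ℂ ℂ eX (M (κ i)) = K i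
      have e1 : (κ i : CC m) ≠ 0 := fun h => s0 (h ▸ (κ i).2)
      have e2 : (κ i : CC m) ∈ S := (κ i).2
      have e3 : M (κ i) = (Matrix.reindexAlgEquiv ℂ ℂ eX).symm (K i) := by
        simp only [M, e1, e2, if_true, if_false, K', dif_pos, Subtype.coe_eta,
          Equiv.symm_apply_apply]
      rw [e3, AlgEquiv.apply_symm_apply]

end final

theorem statement15 (m : ℕ) (hm : 3 ≤ m) (hodd : Odd m) (q : ℂ)
    (hq : IsPrimitiveRoot q m) (n : ℕ) (hn : Even n) (hn4 : 4 ≤ n) :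
    ∀ φ : AlgA m (n - 1) q ≃ₐ[ℂ] AlgA m (n - 1) q,
      ((∀ i : Fin (n - 1), φ (U m (n - 1) q i) = U m (n - 1) q i ^ (m - 1)) ∧
       (∀ i : Fin (n - 1), φ (V m (n - 1) q i) = V m (n - 1) q i ^ (m - 1))) →
      Nonempty
        ((AlgHom.equalizer (φ : AlgA m (n - 1) q →ₐ[ℂ] AlgA m (n - 1) q)
            (AlgHom.id ℂ (AlgA m (n - 1) q))) ≃ₐ[ℂ]
          (Matrix (Fin ((m ^ (n - 2) + 1) / 2)) (Fin ((m ^ (n - 2) + 1) / 2)) ℂ ×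
            Matrix (Fin ((m ^ (n - 2) - 1) / 2)) (Fin ((m ^ (n - 2) - 1) / 2)) ℂ ×
            (Fin ((m ^ 2 - 1) / 2) →
              Matrix (Fin (m ^ (n - 2))) (Fin (m ^ (n - 2))) ℂ))) := by
  intro φ ⟨hu, hv⟩
  obtain ⟨k, hk⟩ : ∃ k, n = 2 * k + 2 := by
    obtain ⟨r, hr⟩ := hn
    exact ⟨r - 1, by omega⟩
  have hN : n - 1 = 2 * k + 1 := by omega
  have hK : n - 2 = 2 * k := by omega
  haveI : NeZero m := ⟨by omega⟩
  have hqm : q ^ m = 1 := hq.pow_eq_one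
  let e : AddChar (ZMod m) ℂ := AddChar.zmodChar m hqm
  have he : e.IsPrimitive := AddChar.zmodChar_primitive_of_primitive_root m hq
  have he1 : e 1 = q := by
    have := AddChar.zmodChar_apply' hqm 1
    simpa using this
  have hq0 : q ≠ 0 := hq.ne_zero (by omega)
  have hbij := rho_bij (k := k) hN he1 hq0 he
  let ρ := AlgEquiv.ofBijective (rho (k := k) hN he1) hbij
  have hcomm : (rho (k := k) hN he1).comp (φ : AlgA m (n - 1) q →ₐ[ℂ] AlgA m (n - 1) q) =
      (sig m k).comp (rho (k := k) hN he1) := by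
    apply RingQuot.ringQuot_ext'
    apply FreeAlgebra.hom_ext
    funext g
    have h1 : φ (gA m (n - 1) q g) = gA m (n - 1) q g ^ (m - 1) := by
      cases g with
      | u i => exact hu i
      | v i => exact hv i
    change rho (k := k) hN he1 (φ (gA m (n - 1) q g)) =
      sig m k (rho (k := k) hN he1 (gA m (n - 1) q g))
    rw [h1, map_pow, rho_gA, sig_opg]
  have hmap : (AlgHom.equalizer (φ : AlgA m (n - 1) q →ₐ[ℂ] AlgA m (n - 1) q)
      (AlgHom.id ℂ (AlgA m (n - 1) q))).map (ρ : AlgA m (n - 1) q →ₐ[ℂ] BB m k) =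
      AlgHom.equalizer (sig m k) (AlgHom.id ℂ (BB m k)) := by
    ext M
    rw [Subalgebra.mem_map, AlgHom.mem_equalizer]
    constructor
    · rintro ⟨a, ha, rfl⟩
      have h1 : φ a = a := ha
      have h2 := DFunLike.congr_fun hcomm a
      change rho (k := k) hN he1 (φ a) = sig m k (rho (k := k) hN he1 a) at h2
      rw [h1] at h2
      exact h2.symm
    · intro hM
      obtain ⟨a, rfl⟩ := hbij.2 M
      refine ⟨a, ?_, rfl⟩
      apply hbij.1
      have h2 := DFunLike.congr_fun hcomm a
      exact h2.trans hM
  obtain ⟨Θ⟩ := fixed_equiv (m := m) (k := k) hodd ((m ^ (n - 2) + 1) / 2)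
    ((m ^ (n - 2) - 1) / 2) ((m ^ 2 - 1) / 2) (m ^ (n - 2)) (by rw [hK]) (by rw [hK]) rfl
    (by rw [hK])
  exact ⟨((ρ.subalgebraMap _).trans (Subalgebra.equivOfEq _ _ hmap)).trans Θ⟩

end Stmt15
end

section
/- In the quaternionic algebra 𝒜₃(Q₈), the elements r_i = (1/2)(1 + u_i + v_i + u_i v_i), i = 1, 2, satisfy the braid relation r₁ r₂ r₁ = r₂ r₁ r₂; moreover each r_i is invertible with inverse r_i^{−1} = (1/2)(1 − u_i − v_i − u_i v_i) (so r_i is unitary for the ∗-structure with u_i^∗ = u_i^{−1}, v_i^∗ = v_i^{−1}). -/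
/-!
STATEMENT 18: In the quaternionic algebra 𝒜₃(Q₈) (generators u₁,v₁,u₂,v₂ with
u_i² = v_i² = −1, u_iv_i = −v_iu_i, u₁u₂ = u₂u₁, v₁v₂ = v₂v₁, u₁v₂ = −v₂u₁,
v₁u₂ = −u₂v₁), the elements r_i = (1/2)(1 + u_i + v_i + u_iv_i) satisfy the
braid relation r₁r₂r₁ = r₂r₁r₂, and each r_i is invertible with inverse
r_i^{−1} = (1/2)(1 − u_i − v_i − u_iv_i).
-/

namespace Stmt18

/-- Generators u₁, v₁, u₂, v₂ of 𝒜₃(Q₈). -/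
inductive Gen : Type
  | u1 : Gen
  | v1 : Gen
  | u2 : Gen
  | v2 : Gen

open Gen in
/-- The defining relations of 𝒜₃(Q₈). -/
inductive Rel : FreeAlgebra ℂ Gen → FreeAlgebra ℂ Gen → Prop
  | usq1 : Rel (FreeAlgebra.ι ℂ u1 ^ 2) (-1)
  | vsq1 : Rel (FreeAlgebra.ι ℂ v1 ^ 2) (-1)
  | usq2 : Rel (FreeAlgebra.ι ℂ u2 ^ 2) (-1)
  | vsq2 : Rel (FreeAlgebra.ι ℂ v2 ^ 2) (-1)
  | anti1 : Rel (FreeAlgebra.ι ℂ u1 * FreeAlgebra.ι ℂ v1)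
      (-(FreeAlgebra.ι ℂ v1 * FreeAlgebra.ι ℂ u1))
  | anti2 : Rel (FreeAlgebra.ι ℂ u2 * FreeAlgebra.ι ℂ v2)
      (-(FreeAlgebra.ι ℂ v2 * FreeAlgebra.ι ℂ u2))
  | uu : Rel (FreeAlgebra.ι ℂ u1 * FreeAlgebra.ι ℂ u2)
      (FreeAlgebra.ι ℂ u2 * FreeAlgebra.ι ℂ u1)
  | vv : Rel (FreeAlgebra.ι ℂ v1 * FreeAlgebra.ι ℂ v2)
      (FreeAlgebra.ι ℂ v2 * FreeAlgebra.ι ℂ v1)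
  | uv : Rel (FreeAlgebra.ι ℂ u1 * FreeAlgebra.ι ℂ v2)
      (-(FreeAlgebra.ι ℂ v2 * FreeAlgebra.ι ℂ u1))
  | vu : Rel (FreeAlgebra.ι ℂ v1 * FreeAlgebra.ι ℂ u2)
      (-(FreeAlgebra.ι ℂ u2 * FreeAlgebra.ι ℂ v1))

/-- The quaternionic algebra 𝒜₃(Q₈). -/
abbrev A : Type := RingQuot Rel

/-- The image of a generator in 𝒜₃(Q₈). -/
noncomputable def gen (g : Gen) : A :=
  RingQuot.mkAlgHom ℂ Rel (FreeAlgebra.ι ℂ g)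

open Gen in
/-- The element r_i = (1/2)(1 + u_i + v_i + u_iv_i). -/
noncomputable def r (i : Fin 2) : A :=
  (1 / 2 : ℂ) • (1 + gen (if i = 0 then u1 else u2) + gen (if i = 0 then v1 else v2)
    + gen (if i = 0 then u1 else u2) * gen (if i = 0 then v1 else v2))

open Gen in
/-- The element (1/2)(1 − u_i − v_i − u_iv_i). -/
noncomputable def s (i : Fin 2) : A :=
  (1 / 2 : ℂ) • (1 - gen (if i = 0 then u1 else u2) - gen (if i = 0 then v1 else v2)
    - gen (if i = 0 then u1 else u2) * gen (if i = 0 then v1 else v2))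

theorem aux_inv {R : Type*} [Ring R] (a b : R) (ha : a * a = -1) (hb : b * b = -1)
    (hba : b * a = -(a * b)) :
    (1 + a + b + a * b) * (1 - a - b - a * b) = 4 ∧
    (1 - a - b - a * b) * (1 + a + b + a * b) = 4 := by
  have ha' : ∀ x, a * (a * x) = -x := fun x => by rw [← mul_assoc, ha]; simp
  have hb' : ∀ x, b * (b * x) = -x := fun x => by rw [← mul_assoc, hb]; simp
  have hba' : ∀ x, b * (a * x) = -(a * (b * x)) := fun x => by
    rw [← mul_assoc, hba]; simp [mul_assoc]
  constructor <;>
  · simp only [mul_add, add_mul, mul_sub, sub_mul, mul_assoc, ha, hb, hba, ha', hb', hba',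
      mul_neg, neg_mul, neg_neg, mul_one, one_mul]
    have h4 : (4 : R) = 1 + 1 + 1 + 1 := by norm_num
    rw [h4]
    abel

theorem aux_braid {R : Type*} [Ring R] (a b c d : R) (ha : a * a = -1) (hb : b * b = -1)
    (hc : c * c = -1) (hd : d * d = -1)
    (hba : b * a = -(a * b)) (hdc : d * c = -(c * d)) (hca : c * a = a * c)
    (hdb : d * b = b * d) (hda : d * a = -(a * d)) (hcb : c * b = -(b * c)) :
    (1 + a + b + a * b) * (1 + c + d + c * d) * (1 + a + b + a * b) =
    (1 + c + d + c * d) * (1 + a + b + a * b) * (1 + c + d + c * d) := by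
  have ha' : ∀ x, a * (a * x) = -x := fun x => by rw [← mul_assoc, ha]; simp
  have hb' : ∀ x, b * (b * x) = -x := fun x => by rw [← mul_assoc, hb]; simp
  have hc' : ∀ x, c * (c * x) = -x := fun x => by rw [← mul_assoc, hc]; simp
  have hd' : ∀ x, d * (d * x) = -x := fun x => by rw [← mul_assoc, hd]; simp
  have hba' : ∀ x, b * (a * x) = -(a * (b * x)) := fun x => by
    rw [← mul_assoc, hba]; simp [mul_assoc]
  have hdc' : ∀ x, d * (c * x) = -(c * (d * x)) := fun x => by
    rw [← mul_assoc, hdc]; simp [mul_assoc]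
  have hda' : ∀ x, d * (a * x) = -(a * (d * x)) := fun x => by
    rw [← mul_assoc, hda]; simp [mul_assoc]
  have hcb' : ∀ x, c * (b * x) = -(b * (c * x)) := fun x => by
    rw [← mul_assoc, hcb]; simp [mul_assoc]
  have hca' : ∀ x, c * (a * x) = a * (c * x) := fun x => by
    rw [← mul_assoc, hca]; simp [mul_assoc]
  have hdb' : ∀ x, d * (b * x) = b * (d * x) := fun x => by
    rw [← mul_assoc, hdb]; simp [mul_assoc]
  simp only [mul_add, add_mul, mul_assoc, ha, hb, hba, ha', hb', hba', hc, hd, hc', hd',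
    hdc, hdc', hda, hda', hcb, hcb', hca, hca', hdb, hdb',
    mul_neg, neg_mul, neg_neg, mul_one, one_mul]
  abel

theorem gen_rel {x y : FreeAlgebra ℂ Gen} (h : Rel x y) :
    RingQuot.mkAlgHom ℂ Rel x = RingQuot.mkAlgHom ℂ Rel y :=
  RingQuot.mkAlgHom_rel ℂ h

theorem statement18 :
    r 0 * r 1 * r 0 = r 1 * r 0 * r 1 ∧
    (∀ i : Fin 2, r i * s i = 1 ∧ s i * r i = 1) := by
  have e1 : gen .u1 * gen .u1 = -1 := by simpa [gen, pow_two] using gen_rel Rel.usq1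
  have e2 : gen .v1 * gen .v1 = -1 := by simpa [gen, pow_two] using gen_rel Rel.vsq1
  have e3 : gen .u2 * gen .u2 = -1 := by simpa [gen, pow_two] using gen_rel Rel.usq2
  have e4 : gen .v2 * gen .v2 = -1 := by simpa [gen, pow_two] using gen_rel Rel.vsq2
  have e5 : gen .u1 * gen .v1 = -(gen .v1 * gen .u1) := by simpa [gen] using gen_rel Rel.anti1
  have e6 : gen .u2 * gen .v2 = -(gen .v2 * gen .u2) := by simpa [gen] using gen_rel Rel.anti2
  have e7 : gen .u1 * gen .u2 = gen .u2 * gen .u1 := by simpa [gen] using gen_rel Rel.uu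
  have e8 : gen .v1 * gen .v2 = gen .v2 * gen .v1 := by simpa [gen] using gen_rel Rel.vv
  have e9 : gen .u1 * gen .v2 = -(gen .v2 * gen .u1) := by simpa [gen] using gen_rel Rel.uv
  have e10 : gen .v1 * gen .u2 = -(gen .u2 * gen .v1) := by simpa [gen] using gen_rel Rel.vu
  have f5 := (neg_eq_iff_eq_neg.mpr e5).symm
  have f6 := (neg_eq_iff_eq_neg.mpr e6).symm
  have f9 := (neg_eq_iff_eq_neg.mpr e9).symm
  have f10 := (neg_eq_iff_eq_neg.mpr e10).symm
  have h4 : (1 / 2 * (1 / 2) : ℂ) • (4 : A) = 1 := by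
    have : (4 : A) = (4 : ℂ) • (1 : A) := by
      rw [← Algebra.algebraMap_eq_smul_one, map_ofNat]
    rw [this, smul_smul]; norm_num
  have r0 : r 0 = (1 / 2 : ℂ) • (1 + gen .u1 + gen .v1 + gen .u1 * gen .v1) := rfl
  have r1 : r 1 = (1 / 2 : ℂ) • (1 + gen .u2 + gen .v2 + gen .u2 * gen .v2) := rfl
  have s0 : s 0 = (1 / 2 : ℂ) • (1 - gen .u1 - gen .v1 - gen .u1 * gen .v1) := rfl
  have s1 : s 1 = (1 / 2 : ℂ) • (1 - gen .u2 - gen .v2 - gen .u2 * gen .v2) := rfl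
  obtain ⟨p1, p2⟩ := aux_inv _ _ e1 e2 f5
  obtain ⟨q1, q2⟩ := aux_inv _ _ e3 e4 f6
  refine ⟨?_, fun i => ?_⟩
  · rw [r0, r1]
    simp only [smul_mul_assoc, mul_smul_comm]
    rw [aux_braid _ _ _ _ e1 e2 e3 e4 f5 f6 e7.symm e8.symm f9 f10]
  · fin_cases i
    · change r 0 * s 0 = 1 ∧ s 0 * r 0 = 1
      rw [r0, s0, smul_mul_smul_comm, smul_mul_smul_comm, p1, p2]
      exact ⟨h4, h4⟩
    · change r 1 * s 1 = 1 ∧ s 1 * r 1 = 1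
      rw [r1, s1, smul_mul_smul_comm, smul_mul_smul_comm, q1, q2]
      exact ⟨h4, h4⟩

end Stmt18
end

section
/- Let x, y, z ∈ ℝ satisfy xy + xz + yz = 0 and x² + y² + z² = 1, and set r_i = (1/(1+𝕚))(1 + 𝕚x·u_i + 𝕚y·u_i v_i + 𝕚z·u_i v_i²) for i = 1, 2, where 𝕚 is the imaginary unit. Then in the algebra 𝒜₃(S₃,τ) the braid relation r₁ r₂ r₁ = r₂ r₁ r₂ holds, and moreover r_i⁴ = 1 (in particular each r_i is invertible of order dividing 4). -/
/-!
STATEMENT 19: In the algebra 𝒜₃(S₃,τ) (generators u₁,v₁,u₂,v₂ with u_i² = 1,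
v_i³ = 1, u_iv_i = v_i²u_i, u₁u₂ = −u₂u₁, v₁v₂ = v₂v₁, u₁v₂ = v₂u₁,
u₂v₁ = v₁u₂), if x, y, z ∈ ℝ satisfy xy + xz + yz = 0 and x² + y² + z² = 1,
then r_i = (1/(1+𝕚))(1 + 𝕚x·u_i + 𝕚y·u_iv_i + 𝕚z·u_iv_i²) satisfy the braid
relation r₁r₂r₁ = r₂r₁r₂ and r_i⁴ = 1.
-/

namespace Stmt19

/-- Generators u₁, v₁, u₂, v₂ of 𝒜₃(S₃,τ). -/
inductive Gen : Type
  | u1 : Gen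
  | v1 : Gen
  | u2 : Gen
  | v2 : Gen

open Gen in
/-- The defining relations of 𝒜₃(S₃,τ). -/
inductive Rel : FreeAlgebra ℂ Gen → FreeAlgebra ℂ Gen → Prop
  | usq1 : Rel (FreeAlgebra.ι ℂ u1 ^ 2) 1
  | usq2 : Rel (FreeAlgebra.ι ℂ u2 ^ 2) 1
  | vcube1 : Rel (FreeAlgebra.ι ℂ v1 ^ 3) 1
  | vcube2 : Rel (FreeAlgebra.ι ℂ v2 ^ 3) 1
  | s3rel1 : Rel (FreeAlgebra.ι ℂ u1 * FreeAlgebra.ι ℂ v1)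
      (FreeAlgebra.ι ℂ v1 ^ 2 * FreeAlgebra.ι ℂ u1)
  | s3rel2 : Rel (FreeAlgebra.ι ℂ u2 * FreeAlgebra.ι ℂ v2)
      (FreeAlgebra.ι ℂ v2 ^ 2 * FreeAlgebra.ι ℂ u2)
  | uu : Rel (FreeAlgebra.ι ℂ u1 * FreeAlgebra.ι ℂ u2)
      (-(FreeAlgebra.ι ℂ u2 * FreeAlgebra.ι ℂ u1))
  | vv : Rel (FreeAlgebra.ι ℂ v1 * FreeAlgebra.ι ℂ v2)
      (FreeAlgebra.ι ℂ v2 * FreeAlgebra.ι ℂ v1)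
  | uv : Rel (FreeAlgebra.ι ℂ u1 * FreeAlgebra.ι ℂ v2)
      (FreeAlgebra.ι ℂ v2 * FreeAlgebra.ι ℂ u1)
  | vu : Rel (FreeAlgebra.ι ℂ u2 * FreeAlgebra.ι ℂ v1)
      (FreeAlgebra.ι ℂ v1 * FreeAlgebra.ι ℂ u2)

/-- The algebra 𝒜₃(S₃,τ). -/
abbrev A : Type := RingQuot Rel

/-- The image of a generator in 𝒜₃(S₃,τ). -/
noncomputable def gen (g : Gen) : A :=
  RingQuot.mkAlgHom ℂ Rel (FreeAlgebra.ι ℂ g)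

open Gen in
/-- The element r_i = (1/(1+𝕚))(1 + 𝕚x·u_i + 𝕚y·u_iv_i + 𝕚z·u_iv_i²). -/
noncomputable def r (x y z : ℝ) (i : Fin 2) : A :=
  (1 / (1 + Complex.I)) •
    (1 + (Complex.I * (x : ℂ)) • gen (if i = 0 then u1 else u2)
      + (Complex.I * (y : ℂ)) •
          (gen (if i = 0 then u1 else u2) * gen (if i = 0 then v1 else v2))
      + (Complex.I * (z : ℂ)) •
          (gen (if i = 0 then u1 else u2) * gen (if i = 0 then v1 else v2) ^ 2))

theorem t_sq {R : Type*} [Ring R] [Algebra ℂ R] (u v : R) (hu : u ^ 2 = 1) (hv : v ^ 3 = 1)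
    (huv : u * v = v ^ 2 * u) (x y z : ℂ) (h1 : x * y + x * z + y * z = 0)
    (h2 : x ^ 2 + y ^ 2 + z ^ 2 = 1) :
    (x • u + y • (u * v) + z • (u * v ^ 2)) * (x • u + y • (u * v) + z • (u * v ^ 2)) = 1 := by
  have hu' : u * u = 1 := by rw [← sq, hu]
  have e1 : u * v * u = v ^ 2 := by rw [huv, mul_assoc, hu', mul_one]
  have e2 : u * v ^ 2 * u = v := by
    have : u * v ^ 2 * u = (u * v * u) * (u * v * u) := by
      calc u * v ^ 2 * u = u * v * 1 * (v * u) := by noncomm_ring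
        _ = _ := by rw [← hu']; noncomm_ring
    rw [this, e1]
    calc v ^ 2 * v ^ 2 = v ^ 3 * v := by noncomm_ring
      _ = v := by rw [hv, one_mul]
  have v4 : v ^ 2 * v ^ 2 = v := by
    calc v ^ 2 * v ^ 2 = v ^ 3 * v := by noncomm_ring
      _ = v := by rw [hv, one_mul]
  have v3 : v ^ 2 * v = 1 := by rw [← pow_succ, hv]
  have v3' : v * v ^ 2 = 1 := by rw [← pow_succ', hv]
  have a1 : u * (u * v) = v := by rw [← mul_assoc, hu', one_mul]
  have a2 : u * (u * v ^ 2) = v ^ 2 := by rw [← mul_assoc, hu', one_mul]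
  have a3 : u * v * (u * v) = 1 := by rw [← mul_assoc, e1, v3]
  have a4 : u * v * (u * v ^ 2) = v := by rw [← mul_assoc, e1, v4]
  have a5 : u * v ^ 2 * (u * v) = v ^ 2 := by rw [← mul_assoc, e2, sq]
  have a6 : u * v ^ 2 * (u * v ^ 2) = 1 := by rw [← mul_assoc, e2, v3']
  simp only [add_mul, mul_add, smul_mul_smul_comm, hu', e1, e2, a1, a2, a3, a4, a5, a6]
  have : (x ^ 2 + y ^ 2 + z ^ 2) • (1 : R) + (x * y + x * z + y * z) • v
      + (x * y + x * z + y * z) • v ^ 2 = 1 := by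
    rw [h1, h2]; simp
  refine Eq.trans ?_ this
  module

theorem t_anti {R : Type*} [Ring R] [Algebra ℂ R] (u v p q : R)
    (huu : u * p = -(p * u)) (hvv : v * q = q * v) (huq : u * q = q * u) (hpv : p * v = v * p)
    (x y z : ℂ) :
    (x • u + y • (u * v) + z • (u * v ^ 2)) * (x • p + y • (p * q) + z • (p * q ^ 2)) =
    -((x • p + y • (p * q) + z • (p * q ^ 2)) * (x • u + y • (u * v) + z • (u * v ^ 2))) := by
  have f : ∀ c : R, (c = x • 1 + y • v + z • v ^ 2) → ∀ d : R,
      (d = x • 1 + y • q + z • q ^ 2) → (u * c) * (p * d) = -((p * d) * (u * c)) := by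
    intro c hc d hd
    have cv : Commute c q := by
      have : Commute v q := hvv
      rw [hc]
      exact (((Commute.one_left q).smul_left x).add_left (this.smul_left y)).add_left
        ((this.pow_left 2).smul_left z)
    have cd : Commute c d := by
      rw [hd]
      exact (((Commute.one_right c).smul_right x).add_right (cv.smul_right y)).add_right
        ((cv.pow_right 2).smul_right z)
    have ud : Commute u d := by
      have : Commute u q := huq
      rw [hd]
      exact (((Commute.one_right u).smul_right x).add_right (this.smul_right y)).add_right
        ((this.pow_right 2).smul_right z)
    have pc : Commute p c := by
      have : Commute p v := hpv
      rw [hc]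
      exact (((Commute.one_right p).smul_right x).add_right (this.smul_right y)).add_right
        ((this.pow_right 2).smul_right z)
    calc (u * c) * (p * d) = u * (c * p) * d := by noncomm_ring
      _ = (u * p) * (c * d) := by rw [← pc.eq]; noncomm_ring
      _ = -(p * (u * d) * c) := by rw [huu, cd.eq]; noncomm_ring
      _ = _ := by rw [ud.eq]; noncomm_ring
  have := f _ rfl _ rfl
  simpa only [mul_add, mul_smul_comm, mul_one] using this

theorem braid_aux {R : Type*} [Ring R] [Algebra ℂ R] (a b : R) (k : ℂ)
    (ha : a * a = -1) (hb : b * b = -1) (hab : a * b = -(b * a)) :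
    (k • (1 + a)) * (k • (1 + b)) * (k • (1 + a))
      = (k • (1 + b)) * (k • (1 + a)) * (k • (1 + b)) := by
  simp only [smul_mul_smul_comm]
  congr 1
  have h1 : a * b * a = b := by rw [hab, neg_mul, mul_assoc, ha]; simp
  have h2 : b * a * b = a := by rw [mul_assoc, hab, mul_neg, ← mul_assoc, hb]; simp
  calc (1 + a) * (1 + b) * (1 + a) = 1 + a + a + b + a * a + a * b + b * a + a * b * a := by
        noncomm_ring
    _ = 1 + b + b + a + b * b + a * b + b * a + b * a * b := by
        rw [h1, h2, ha, hb]; abel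
    _ = _ := by noncomm_ring

theorem four_aux {R : Type*} [Ring R] [Algebra ℂ R] (t : R) (ht : t * t = 1) :
    ((1 / (1 + Complex.I)) • (1 + Complex.I • t)) ^ 4 = 1 := by
  have hI : (1 + Complex.I) ≠ 0 := by
    intro h
    have := congrArg Complex.re h
    simp at this
  have hk : (1 / (1 + Complex.I)) * (1 / (1 + Complex.I)) * (2 * Complex.I) = 1 := by
    field_simp
    linear_combination -Complex.I_sq
  have hs : ((1 / (1 + Complex.I)) • (1 + Complex.I • t)) *
      ((1 / (1 + Complex.I)) • (1 + Complex.I • t)) = t := by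
    rw [smul_mul_smul_comm]
    have : (1 + Complex.I • t) * (1 + Complex.I • t) = (2 * Complex.I) • t := by
      simp only [add_mul, mul_add, smul_mul_smul_comm, ht, Complex.I_mul_I, one_mul, mul_one]
      module
    rw [this, smul_smul, hk, one_smul]
  rw [show 4 = 2 * 2 from rfl, pow_mul, sq (_ • _), hs, sq, ht]

noncomputable def tt (x y z : ℂ) (u v : A) : A := x • u + y • (u * v) + z • (u * v ^ 2)

open Gen in
theorem r_eq (x y z : ℝ) (i : Fin 2) : r x y z i = (1 / (1 + Complex.I)) • (1 + Complex.I •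
    tt x y z (gen (if i = 0 then u1 else u2)) (gen (if i = 0 then v1 else v2))) := by
  unfold r tt
  congr 1
  module

theorem rel_eq {a b : FreeAlgebra ℂ Gen} (h : Rel a b) :
    RingQuot.mkAlgHom ℂ Rel a = RingQuot.mkAlgHom ℂ Rel b := RingQuot.mkAlgHom_rel ℂ h

theorem statement19 (x y z : ℝ) (h1 : x * y + x * z + y * z = 0)
    (h2 : x ^ 2 + y ^ 2 + z ^ 2 = 1) :
    r x y z 0 * r x y z 1 * r x y z 0 = r x y z 1 * r x y z 0 * r x y z 1 ∧
    (∀ i : Fin 2, r x y z i ^ 4 = 1) := by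
  have c1 : (x : ℂ) * y + x * z + y * z = 0 := by exact_mod_cast h1
  have c2 : (x : ℂ) ^ 2 + y ^ 2 + z ^ 2 = 1 := by exact_mod_cast h2
  have s1 : tt x y z (gen Gen.u1) (gen Gen.v1) * tt x y z (gen Gen.u1) (gen Gen.v1) = 1 :=
    t_sq (gen Gen.u1) (gen Gen.v1) (by have h := rel_eq Rel.usq1; simp only [map_mul, map_pow, map_one, map_neg] at h; exact h) (by have h := rel_eq Rel.vcube1; simp only [map_mul, map_pow, map_one, map_neg] at h; exact h)
      (by have h := rel_eq Rel.s3rel1; simp only [map_mul, map_pow, map_one, map_neg] at h; exact h) _ _ _ c1 c2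
  have s2 : tt x y z (gen Gen.u2) (gen Gen.v2) * tt x y z (gen Gen.u2) (gen Gen.v2) = 1 :=
    t_sq (gen Gen.u2) (gen Gen.v2) (by have h := rel_eq Rel.usq2; simp only [map_mul, map_pow, map_one, map_neg] at h; exact h) (by have h := rel_eq Rel.vcube2; simp only [map_mul, map_pow, map_one, map_neg] at h; exact h)
      (by have h := rel_eq Rel.s3rel2; simp only [map_mul, map_pow, map_one, map_neg] at h; exact h) _ _ _ c1 c2
  have s3 : tt x y z (gen Gen.u1) (gen Gen.v1) * tt x y z (gen Gen.u2) (gen Gen.v2) =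
      -(tt x y z (gen Gen.u2) (gen Gen.v2) * tt x y z (gen Gen.u1) (gen Gen.v1)) :=
    t_anti (gen Gen.u1) (gen Gen.v1) (gen Gen.u2) (gen Gen.v2) (by have h := rel_eq Rel.uu; simp only [map_mul, map_pow, map_one, map_neg] at h; exact h)
      (by have h := rel_eq Rel.vv; simp only [map_mul, map_pow, map_one, map_neg] at h; exact h)
      (by have h := rel_eq Rel.uv; simp only [map_mul, map_pow, map_one, map_neg] at h; exact h)
      (by have h := rel_eq Rel.vu; simp only [map_mul, map_pow, map_one, map_neg] at h; exact h) _ _ _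
  constructor
  · rw [r_eq, r_eq]
    apply braid_aux
    · simp [s1, smul_smul]
    · simp [s2, smul_smul]
    · simp [s3]
  · intro i
    rw [r_eq]
    apply four_aux
    fin_cases i
    · simpa using s1
    · simpa using s2

end Stmt19
end
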